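/- If α < λ_{k+1}(V), then for every real number β the functional J_{α,β}(u) = (1/2)∫_V (|∇u|² − α u²) dμ − β log ∫_V h e^u dμ attains its infimum over E_k^⊥ at some u ∈ E_k^⊥, and this minimizer u satisfies the equation Δu + αu = −β h e^u / (∫_V h e^u dμ) + β / Vol(V) + Σ_{s=1}^{k} Σ_{i=1}^{n_s} (β ∫_V h u_{si} e^u dμ / ∫_V h e^u dμ) · u_{si} on V. -/

import Mathlib

open Finset

variable {V : Type*}

/-- Integral of `g` over `V` with respect to the measure `μ`. -/
noncomputable def intV [Fintype V] (μ g : V → ℝ) : ℝ := ∑ x, μ x * g x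

/-- Volume of `V` with respect to the measure `μ`. -/
noncomputable def volV [Fintype V] (μ : V → ℝ) : ℝ := ∑ x, μ x

/-- The space `H` of functions with zero mean. -/
def Hsp [Fintype V] (μ : V → ℝ) : Set (V → ℝ) := {u | intV μ u = 0}

/-- `|∇u|²(x)`, the squared length of the gradient of `u` at `x`. -/
noncomputable def gradSq [Fintype V] (G : SimpleGraph V) [DecidableRel G.Adj]
    (w : V → V → ℝ) (μ : V → ℝ) (u : V → ℝ) (x : V) : ℝ :=
  (1 / (2 * μ x)) * ∑ y, if G.Adj x y then w x y * (u y - u x) ^ 2 else 0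

/-- The `μ`-Laplacian `Δu(x)`. -/
noncomputable def lapV [Fintype V] (G : SimpleGraph V) [DecidableRel G.Adj]
    (w : V → V → ℝ) (μ : V → ℝ) (u : V → ℝ) (x : V) : ℝ :=
  (1 / μ x) * ∑ y, if G.Adj x y then w x y * (u y - u x) else 0

/-- The functional `J_β`. -/
noncomputable def Jb [Fintype V] (G : SimpleGraph V) [DecidableRel G.Adj]
    (w : V → V → ℝ) (μ h : V → ℝ) (β : ℝ) (u : V → ℝ) : ℝ :=
  (1 / 2) * intV μ (gradSq G w μ u)
    - β * Real.log (intV μ (fun x => h x * Real.exp (u x)))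

/-- The functional `J_{α,β}`. -/
noncomputable def Jab [Fintype V] (G : SimpleGraph V) [DecidableRel G.Adj]
    (w : V → V → ℝ) (μ h : V → ℝ) (α β : ℝ) (u : V → ℝ) : ℝ :=
  (1 / 2) * intV μ (fun x => gradSq G w μ u x - α * u x ^ 2)
    - β * Real.log (intV μ (fun x => h x * Real.exp (u x)))

/-- The first non-zero eigenvalue `λ₁(V)` of `-Δ`, defined variationally. -/
noncomputable def lam1V [Fintype V] (G : SimpleGraph V) [DecidableRel G.Adj]
    (w : V → V → ℝ) (μ : V → ℝ) : ℝ :=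
  sInf ((fun u => intV μ (gradSq G w μ u)) ''
    {u | u ∈ Hsp μ ∧ intV μ (fun x => u x ^ 2) = 1})

/-- The eigenspace of `-Δ` with eigenvalue `c` (inside `H`). -/
def eigSp [Fintype V] (G : SimpleGraph V) [DecidableRel G.Adj]
    (w : V → V → ℝ) (μ : V → ℝ) (c : ℝ) : Set (V → ℝ) :=
  {v | intV μ v = 0 ∧ ∀ x, -(lapV G w μ v x) = c * v x}

/-- `E_k^⊥`: functions in `H` orthogonal to the eigenspaces of the first `k`
distinct non-zero eigenvalues (`lam` lists the distinct non-zero eigenvalues,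
0-indexed, so `lam ⟨s⟩` is `λ_{s+1}(V)`). -/
def EkPerp [Fintype V] (G : SimpleGraph V) [DecidableRel G.Adj]
    (w : V → V → ℝ) (μ : V → ℝ) {m : ℕ} (lam : Fin m → ℝ) (k : ℕ) : Set (V → ℝ) :=
  {u | u ∈ Hsp μ ∧ ∀ s : Fin m, (s : ℕ) < k → ∀ v ∈ eigSp G w μ (lam s),
    intV μ (fun x => u x * v x) = 0}

/-- The weighted `L²` inner product of functions on `V`, as a bilinear map. -/
noncomputable def ipV [Fintype V] (μ : V → ℝ) : (V → ℝ) →ₗ[ℝ] (V → ℝ) →ₗ[ℝ] ℝ :=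
  LinearMap.mk₂ ℝ (fun f g => ∑ x, μ x * (f x * g x))
    (fun f f' g => by simp [add_mul, mul_add, sum_add_distrib])
    (fun c f g => by
      simp only [Pi.smul_apply, smul_eq_mul, mul_sum]
      exact sum_congr rfl fun x _ => by ring)
    (fun f g g' => by simp [mul_add, sum_add_distrib])
    (fun c f g => by
      simp only [Pi.smul_apply, smul_eq_mul, mul_sum]
      exact sum_congr rfl fun x _ => by ring)

theorem ipV_apply [Fintype V] (μ f g : V → ℝ) :
    ipV μ f g = ∑ x, μ x * (f x * g x) := rfl

theorem ipV_comm [Fintype V] (μ f g : V → ℝ) : ipV μ f g = ipV μ g f := by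
  simp only [ipV_apply, mul_comm (f _)]

theorem ipV_one [Fintype V] (μ f : V → ℝ) : ipV μ f 1 = intV μ f := by
  simp [ipV_apply, intV]

theorem ipV_self_nonneg [Fintype V] {μ : V → ℝ} (hμ : ∀ x, 0 < μ x) (f : V → ℝ) :
    0 ≤ ipV μ f f :=
  sum_nonneg fun x _ => mul_nonneg (hμ x).le (mul_self_nonneg _)

theorem eq_zero_of_ipV_self [Fintype V] {μ : V → ℝ} (hμ : ∀ x, 0 < μ x) {f : V → ℝ}
    (hf : ipV μ f f = 0) : f = 0 := by
  rw [ipV_apply, sum_eq_zero_iff_of_nonneg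
    fun x _ => mul_nonneg (hμ x).le (mul_self_nonneg _)] at hf
  funext x
  simpa [(hμ x).ne'] using hf x (mem_univ x)

theorem continuous_ipV_self [Fintype V] (μ : V → ℝ) : Continuous fun f => ipV μ f f := by
  simp only [ipV_apply]
  fun_prop

theorem exists_mul_norm_sq_le_ipV [Fintype V] [Nonempty V] {μ : V → ℝ} (hμ : ∀ x, 0 < μ x) :
    ∃ a > 0, ∀ f : V → ℝ, a * ‖f‖ ^ 2 ≤ ipV μ f f := by
  obtain ⟨x₀, hx₀⟩ := Finite.exists_min μ
  refine ⟨μ x₀, hμ x₀, fun f => ?_⟩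
  have key : ‖f‖ ≤ √(ipV μ f f / μ x₀) := by
    refine (pi_norm_le_iff_of_nonneg (Real.sqrt_nonneg _)).2 fun x => ?_
    refine Real.abs_le_sqrt ?_
    rw [le_div_iff₀ (hμ x₀)]
    calc f x ^ 2 * μ x₀ ≤ μ x * (f x * f x) := by nlinarith [hx₀ x, sq_nonneg (f x)]
      _ ≤ ipV μ f f := single_le_sum (f := fun x => μ x * (f x * f x))
          (fun y _ => mul_nonneg (hμ y).le (mul_self_nonneg _)) (mem_univ x)
  have h0 : 0 ≤ ipV μ f f / μ x₀ := div_nonneg (ipV_self_nonneg hμ f) (hμ x₀).le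
  have := (Real.le_sqrt (norm_nonneg _) h0).1 key
  rwa [le_div_iff₀ (hμ x₀), mul_comm] at this

section Laplacian

variable [Fintype V] (G : SimpleGraph V) [DecidableRel G.Adj] (w : V → V → ℝ) (μ : V → ℝ)

/-- The `μ`-Laplacian as a linear map. -/
noncomputable def lapLin : (V → ℝ) →ₗ[ℝ] (V → ℝ) where
  toFun u := lapV G w μ u
  map_add' u v := by
    funext x
    simp only [lapV, Pi.add_apply, ← mul_add, ← sum_add_distrib]
    congr 1
    exact sum_congr rfl fun y _ => by split_ifs <;> ring
  map_smul' c u := by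
    funext x
    simp only [lapV, Pi.smul_apply, smul_eq_mul, mul_sum, RingHom.id_apply]
    exact sum_congr rfl fun y _ => by split_ifs <;> ring

theorem lapLin_apply (u : V → ℝ) : lapLin G w μ u = lapV G w μ u := rfl

theorem lapLin_one : lapLin G w μ 1 = 0 := by
  funext x
  simp [lapLin_apply, lapV]

theorem lapLin_eq_smul_iff {c : ℝ} {v : V → ℝ} :
    lapLin G w μ v = (-c) • v ↔ ∀ x, -(lapV G w μ v x) = c * v x := by
  simp only [funext_iff, lapLin_apply, Pi.smul_apply, smul_eq_mul, neg_mul]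
  exact forall_congr' fun x => neg_eq_iff_eq_neg.symm

variable {G w μ}

theorem ipV_lapLin (hμ : ∀ x, 0 < μ x) (u v : V → ℝ) :
    ipV μ (lapLin G w μ u) v
      = ∑ x, ∑ y, if G.Adj x y then w x y * (u y - u x) * v x else 0 := by
  refine sum_congr rfl fun x _ => ?_
  have := (hμ x).ne'
  rw [lapLin_apply, lapV, ← mul_assoc, ← mul_assoc, mul_one_div_cancel this, one_mul, sum_mul]
  exact sum_congr rfl fun y _ => by split_ifs <;> ring

theorem ipV_lapLin_eq_neg (hws : ∀ x y, w x y = w y x) (hμ : ∀ x, 0 < μ x) (u v : V → ℝ) :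
    ipV μ (lapLin G w μ u) v
      = -((1 / 2) * ∑ x, ∑ y, if G.Adj x y then w x y * ((u y - u x) * (v y - v x)) else 0) := by
  have h₁ := ipV_lapLin (G := G) (w := w) hμ u v
  have h₂ := h₁
  rw [sum_comm] at h₂
  have h₃ : ipV μ (lapLin G w μ u) v + ipV μ (lapLin G w μ u) v
      = -∑ x, ∑ y, if G.Adj x y then w x y * ((u y - u x) * (v y - v x)) else 0 := by
    nth_rw 1 [h₁]
    rw [h₂]
    simp only [← sum_add_distrib, ← sum_neg_distrib]
    refine sum_congr rfl fun x _ => sum_congr rfl fun y _ => ?_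
    simp only [G.adj_comm y x, hws y x]
    split_ifs <;> ring
  linarith

theorem ipV_lapLin_comm (hws : ∀ x y, w x y = w y x) (hμ : ∀ x, 0 < μ x) (u v : V → ℝ) :
    ipV μ (lapLin G w μ u) v = ipV μ u (lapLin G w μ v) := by
  rw [ipV_comm μ u, ipV_lapLin_eq_neg hws hμ, ipV_lapLin_eq_neg hws hμ]
  simp only [mul_comm (u _ - u _)]

theorem intV_gradSq (hws : ∀ x y, w x y = w y x) (hμ : ∀ x, 0 < μ x) (u : V → ℝ) :
    intV μ (gradSq G w μ u) = -ipV μ (lapLin G w μ u) u := by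
  rw [ipV_lapLin_eq_neg hws hμ, neg_neg, intV, mul_sum]
  refine sum_congr rfl fun x _ => ?_
  have := (hμ x).ne'
  simp only [gradSq, ← sq]
  field_simp

theorem eq_of_lapLin_eq_zero (hG : G.Connected) (hws : ∀ x y, w x y = w y x)
    (hwp : ∀ x y, G.Adj x y → 0 < w x y) (hμ : ∀ x, 0 < μ x) {u : V → ℝ}
    (hu : lapLin G w μ u = 0) (x y : V) : u x = u y := by
  have h₁ := ipV_lapLin_eq_neg (G := G) hws hμ u u
  have hnn : ∀ x y, 0 ≤ if G.Adj x y then w x y * ((u y - u x) * (u y - u x)) else 0 := by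
    intro x y
    split_ifs with hxy
    · exact mul_nonneg (hwp x y hxy).le (mul_self_nonneg _)
    · exact le_rfl
  have h₂ : ∑ x, ∑ y, (if G.Adj x y then w x y * ((u y - u x) * (u y - u x)) else 0) = 0 := by
    rw [hu, map_zero, LinearMap.zero_apply] at h₁
    linarith
  have h₃ : ∀ x y, G.Adj x y → u x = u y := by
    intro x y hxy
    rw [sum_eq_zero_iff_of_nonneg fun x _ => sum_nonneg fun y _ => hnn x y] at h₂
    have h₄ := h₂ x (mem_univ x)
    rw [sum_eq_zero_iff_of_nonneg fun y _ => hnn x y] at h₄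
    have h₅ := h₄ y (mem_univ y)
    rw [if_pos hxy, mul_eq_zero, mul_self_eq_zero] at h₅
    rcases h₅ with h₅ | h₅
    · exact absurd h₅ (hwp x y hxy).ne'
    · linarith
  obtain ⟨p⟩ := hG.preconnected x y
  induction p with
  | nil => rfl
  | cons hadj _ ih => exact (h₃ _ _ hadj).trans ih

variable (G w μ) in
/-- `EkPerp` as a subspace. -/
noncomputable def perpSubmodule {m : ℕ} (lam : Fin m → ℝ) (k : ℕ) : Submodule ℝ (V → ℝ) where
  carrier := EkPerp G w μ lam k
  zero_mem' := by simp [EkPerp, Hsp, intV]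
  add_mem' {u v} hu hv := by
    refine ⟨?_, fun s hs e he => ?_⟩
    · have h₁ : ipV μ u 1 = 0 := (ipV_one μ u).trans hu.1
      have h₂ : ipV μ v 1 = 0 := (ipV_one μ v).trans hv.1
      change intV μ (u + v) = 0
      rw [← ipV_one, map_add, LinearMap.add_apply, h₁, h₂, add_zero]
    · change ipV μ (u + v) e = 0
      have h₁ : ipV μ u e = 0 := hu.2 s hs e he
      have h₂ : ipV μ v e = 0 := hv.2 s hs e he
      rw [map_add, LinearMap.add_apply, h₁, h₂, add_zero]
  smul_mem' c u hu := by
    refine ⟨?_, fun s hs e he => ?_⟩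
    · have h₁ : ipV μ u 1 = 0 := (ipV_one μ u).trans hu.1
      change intV μ (c • u) = 0
      rw [← ipV_one, map_smul, LinearMap.smul_apply, h₁, smul_zero]
    · change ipV μ (c • u) e = 0
      have h₁ : ipV μ u e = 0 := hu.2 s hs e he
      rw [map_smul, LinearMap.smul_apply, h₁, smul_zero]

theorem mem_perpSubmodule {m : ℕ} {lam : Fin m → ℝ} {k : ℕ} {u : V → ℝ} :
    u ∈ perpSubmodule G w μ lam k ↔ ipV μ u 1 = 0 ∧
      ∀ s : Fin m, (s : ℕ) < k → ∀ v ∈ eigSp G w μ (lam s), ipV μ u v = 0 := by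
  rw [ipV_one]
  exact Iff.rfl

theorem lapLin_mem_perpSubmodule (hws : ∀ x y, w x y = w y x) (hμ : ∀ x, 0 < μ x) {m : ℕ}
    {lam : Fin m → ℝ} {k : ℕ} {u : V → ℝ} (hu : u ∈ perpSubmodule G w μ lam k) :
    lapLin G w μ u ∈ perpSubmodule G w μ lam k := by
  rw [mem_perpSubmodule] at hu ⊢
  refine ⟨by rw [ipV_lapLin_comm hws hμ, lapLin_one, map_zero], fun s hs v hv => ?_⟩
  rw [ipV_lapLin_comm hws hμ, (lapLin_eq_smul_iff G w μ).2 hv.2, map_smul, hu.2 s hs v hv,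
    smul_zero]

theorem eq_zero_of_forall_quadratic_nonneg {a b : ℝ} (hab : ∀ t : ℝ, 0 ≤ 2 * t * b + t ^ 2 * a) :
    b = 0 := by
  have h₁ : HasDerivAt (fun t : ℝ => 2 * t * b + t ^ 2 * a) (2 * b) 0 := by
    have h₂ := (((hasDerivAt_id (0 : ℝ)).const_mul 2).mul_const b).add
      (((hasDerivAt_id (0 : ℝ)).pow 2).mul_const a)
    refine HasDerivAt.congr_deriv h₂ ?_
    simp
  have h₂ : IsLocalMin (fun t : ℝ => 2 * t * b + t ^ 2 * a) 0 :=
    Filter.Eventually.of_forall fun t => by simpa using hab t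
  linarith [h₂.hasDerivAt_eq_zero h₁]

theorem exists_eigenvector_of_ne_bot (hws : ∀ x y, w x y = w y x) (hμ : ∀ x, 0 < μ x)
    [Nonempty V] {W : Submodule ℝ (V → ℝ)} (hW : ∀ u ∈ W, lapLin G w μ u ∈ W) (hbot : W ≠ ⊥) :
    ∃ c : ℝ, (∃ u ∈ W, u ≠ 0 ∧ lapLin G w μ u = (-c) • u) ∧
      ∀ v ∈ W, c * ipV μ v v ≤ -ipV μ (lapLin G w μ v) v := by
  have hpos : ∀ v : V → ℝ, v ≠ 0 → 0 < ipV μ v v := fun v hv =>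
    lt_of_le_of_ne (ipV_self_nonneg hμ v) fun h0 => hv (eq_zero_of_ipV_self hμ h0.symm)
  have hnormalize : ∀ v ∈ W, v ≠ 0 → (√(ipV μ v v))⁻¹ • v ∈ {v | v ∈ W ∧ ipV μ v v = 1} := by
    intro v hv hv0
    refine ⟨W.smul_mem _ hv, ?_⟩
    have h₁ := hpos v hv0
    have h₂ := Real.sqrt_pos.2 h₁
    have h₃ := Real.mul_self_sqrt h₁.le
    rw [map_smul, map_smul, LinearMap.smul_apply, smul_eq_mul, smul_eq_mul]
    nth_rw 3 [← h₃]
    field_simp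
  have hcomp : IsCompact {v : V → ℝ | v ∈ W ∧ ipV μ v v = 1} := by
    refine Metric.isCompact_of_isClosed_isBounded ?_ ?_
    · exact W.closed_of_finiteDimensional.inter
        (isClosed_eq (continuous_ipV_self μ) continuous_const)
    · obtain ⟨a, ha, hle⟩ := exists_mul_norm_sq_le_ipV hμ
      refine isBounded_iff_forall_norm_le.2 ⟨√(1 / a), fun v hv => ?_⟩
      refine Real.le_sqrt_of_sq_le ?_
      rw [le_div_iff₀ ha, mul_comm, ← hv.2]
      exact hle v
  obtain ⟨v₀, hv₀, hv₀'⟩ := W.ne_bot_iff.1 hbot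
  have hcont : Continuous fun v => -ipV μ (lapLin G w μ v) v := by
    have hL : Continuous (lapLin G w μ) := LinearMap.continuous_of_finiteDimensional _
    simp only [ipV_apply]
    fun_prop
  obtain ⟨u, hu, hmin⟩ := hcomp.exists_isMinOn ⟨_, hnormalize v₀ hv₀ hv₀'⟩ hcont.continuousOn
  set c := -ipV μ (lapLin G w μ u) u
  have hray : ∀ v ∈ W, c * ipV μ v v ≤ -ipV μ (lapLin G w μ v) v := by
    intro v hv
    rcases eq_or_ne v 0 with rfl | hv0
    · simp
    have h₁ := hpos v hv0
    have h₂ : c ≤ -ipV μ (lapLin G w μ ((√(ipV μ v v))⁻¹ • v)) ((√(ipV μ v v))⁻¹ • v) :=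
      hmin (hnormalize v hv hv0)
    rw [map_smul, map_smul, map_smul, LinearMap.smul_apply, smul_eq_mul, smul_eq_mul, ← mul_assoc,
      ← mul_inv, Real.mul_self_sqrt h₁.le, ← mul_neg, ← div_eq_inv_mul, le_div_iff₀ h₁] at h₂
    exact h₂
  refine ⟨c, ⟨u, hu.1, ?_, ?_⟩, hray⟩
  · rintro rfl
    simpa using hu.2
  have hvar : ∀ v ∈ W, ipV μ (lapLin G w μ u) v + c * ipV μ u v = 0 := by
    intro v hv
    have h₁ : ∀ t : ℝ, 0 ≤ 2 * t * -(ipV μ (lapLin G w μ u) v + c * ipV μ u v)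
        + t ^ 2 * (-ipV μ (lapLin G w μ v) v - c * ipV μ v v) := by
      intro t
      have h₂ := hray (u + t • v) (W.add_mem hu.1 (W.smul_mem t hv))
      have h₃ : ipV μ (lapLin G w μ v) u = ipV μ (lapLin G w μ u) v := by
        rw [ipV_lapLin_comm hws hμ, ipV_comm]
      simp only [map_add, map_smul, LinearMap.add_apply, LinearMap.smul_apply, smul_eq_mul, hu.2,
        h₃, ipV_comm μ v u] at h₂
      linarith
    exact neg_eq_zero.1 (eq_zero_of_forall_quadratic_nonneg h₁)
  have hzero : lapLin G w μ u + c • u = 0 := by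
    refine eq_zero_of_ipV_self hμ ?_
    have h₁ := hvar _ (W.add_mem (hW u hu.1) (W.smul_mem c hu.1))
    rwa [LinearMap.map_add₂, LinearMap.map_smul₂, smul_eq_mul]
  rw [neg_smul]
  exact eq_neg_of_add_eq_zero_left hzero

theorem lam_mul_ipV_le (hG : G.Connected) (hws : ∀ x y, w x y = w y x)
    (hwp : ∀ x y, G.Adj x y → 0 < w x y) (hμ : ∀ x, 0 < μ x) {m : ℕ} {lam : Fin m → ℝ}
    (hmono : StrictMono lam)
    (hrange : ∀ c : ℝ, c ≠ 0 → (∃ v : V → ℝ, v ≠ 0 ∧ ∀ x, -(lapV G w μ v x) = c * v x) →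
      c ∈ Set.range lam)
    {k : ℕ} (hk : k < m) {v : V → ℝ} (hv : v ∈ perpSubmodule G w μ lam k) :
    lam ⟨k, hk⟩ * ipV μ v v ≤ -ipV μ (lapLin G w μ v) v := by
  have := hG.nonempty
  by_cases hbot : perpSubmodule G w μ lam k = ⊥
  · rw [hbot, Submodule.mem_bot] at hv
    simp [hv]
  obtain ⟨c, ⟨u, hu, hu0, hlap⟩, hle⟩ := exists_eigenvector_of_ne_bot (G := G) hws hμ
    (fun u hu => lapLin_mem_perpSubmodule hws hμ hu) hbot
  have hu' := mem_perpSubmodule.1 hu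
  have hc0 : c ≠ 0 := by
    rintro rfl
    rw [neg_zero, zero_smul] at hlap
    have hconst := eq_of_lapLin_eq_zero hG hws hwp hμ hlap
    refine hu0 (eq_zero_of_ipV_self hμ ?_)
    let x₀ := Classical.arbitrary V
    have : u = u x₀ • 1 := funext fun x => by simpa using hconst x x₀
    nth_rw 2 [this]
    rw [map_smul, hu'.1, smul_zero]
  obtain ⟨s, rfl⟩ := hrange c hc0 ⟨u, hu0, (lapLin_eq_smul_iff G w μ).1 hlap⟩
  have hs : k ≤ s := by
    by_contra! hs
    refine hu0 (eq_zero_of_ipV_self hμ (hu'.2 s hs u ⟨?_, (lapLin_eq_smul_iff G w μ).1 hlap⟩))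
    rw [← ipV_one]
    exact hu'.1
  have hlam : lam ⟨k, hk⟩ ≤ lam s := hmono.monotone hs
  exact (mul_le_mul_of_nonneg_right hlam (ipV_self_nonneg hμ v)).trans (hle v hv)

theorem ipV_eq_zero_of_eigenvalue_ne (hws : ∀ x y, w x y = w y x) (hμ : ∀ x, 0 < μ x)
    {a b : ℝ} (hab : a ≠ b) {u v : V → ℝ} (hu : u ∈ eigSp G w μ a) (hv : v ∈ eigSp G w μ b) :
    ipV μ u v = 0 := by
  have h₁ := ipV_lapLin_comm (G := G) hws hμ u v
  rw [(lapLin_eq_smul_iff G w μ).2 hu.2, (lapLin_eq_smul_iff G w μ).2 hv.2, map_smul, map_smul,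
    LinearMap.smul_apply, smul_eq_mul, smul_eq_mul] at h₁
  have h₂ : (b - a) * ipV μ u v = 0 := by linarith
  exact (mul_eq_zero.1 h₂).resolve_left (sub_ne_zero.2 hab.symm)

end Laplacian

section Functional

variable [Fintype V] {G : SimpleGraph V} [DecidableRel G.Adj] {w : V → V → ℝ} {μ h : V → ℝ}

theorem intV_mul_exp_pos [Nonempty V] (hμ : ∀ x, 0 < μ x) (hh : ∀ x, 0 < h x) (u : V → ℝ) :
    0 < intV μ fun x => h x * Real.exp (u x) :=
  sum_pos (fun x _ => mul_pos (hμ x) (mul_pos (hh x) (Real.exp_pos _))) univ_nonempty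

theorem abs_log_intV_mul_exp_le [Nonempty V] (hμ : ∀ x, 0 < μ x) (hh : ∀ x, 0 < h x)
    (u : V → ℝ) :
    |Real.log (intV μ fun x => h x * Real.exp (u x))| ≤ |Real.log (intV μ h)| + ‖u‖ := by
  have hI : 0 < intV μ h := sum_pos (fun x _ => mul_pos (hμ x) (hh x)) univ_nonempty
  have hu : ∀ x, |u x| ≤ ‖u‖ := fun x => norm_le_pi_norm u x
  have hle : (intV μ fun x => h x * Real.exp (u x)) ≤ intV μ h * Real.exp ‖u‖ := by
    rw [intV, intV, sum_mul]
    refine sum_le_sum fun x _ => ?_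
    rw [mul_assoc]
    have := hμ x
    have := hh x
    have := (abs_le.1 (hu x)).2
    gcongr
  have hge : intV μ h * Real.exp (-‖u‖) ≤ intV μ fun x => h x * Real.exp (u x) := by
    rw [intV, intV, sum_mul]
    refine sum_le_sum fun x _ => ?_
    rw [mul_assoc]
    have := hμ x
    have := hh x
    have := (abs_le.1 (hu x)).1
    gcongr
  have h₁ := Real.log_le_log (intV_mul_exp_pos hμ hh u) hle
  have h₂ := Real.log_le_log (mul_pos hI (Real.exp_pos _)) hge
  rw [Real.log_mul hI.ne' (Real.exp_pos _).ne', Real.log_exp] at h₁ h₂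
  rw [abs_le]
  constructor <;> linarith [neg_abs_le (Real.log (intV μ h)), le_abs_self (Real.log (intV μ h))]

theorem Jab_eq (hws : ∀ x y, w x y = w y x) (hμ : ∀ x, 0 < μ x) (α β : ℝ) (u : V → ℝ) :
    Jab G w μ h α β u = (1 / 2) * (-ipV μ (lapLin G w μ u) u - α * ipV μ u u)
      - β * Real.log (intV μ fun x => h x * Real.exp (u x)) := by
  rw [Jab, ← intV_gradSq hws hμ]
  congr 2
  rw [intV, intV, ipV_apply, mul_sum, ← sum_sub_distrib]
  exact sum_congr rfl fun x _ => by ring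

theorem continuous_Jab [Nonempty V] (hμ : ∀ x, 0 < μ x)
    (hh : ∀ x, 0 < h x) (α β : ℝ) : Continuous (Jab G w μ h α β) := by
  have h₁ : Continuous fun u : V → ℝ => intV μ (fun x => gradSq G w μ u x - α * u x ^ 2) := by
    simp only [intV, gradSq, ← sum_filter]
    fun_prop
  have h₂ : Continuous fun u : V → ℝ => intV μ fun x => h x * Real.exp (u x) := by
    simp only [intV]
    fun_prop
  exact (h₁.const_mul _).sub ((h₂.log fun u => (intV_mul_exp_pos hμ hh u).ne').const_mul β)

theorem exists_isMinOn_Jab [Nonempty V] (hws : ∀ x y, w x y = w y x) (hμ : ∀ x, 0 < μ x)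
    (hh : ∀ x, 0 < h x) {α Λ : ℝ} (β : ℝ) (hα : α < Λ) (W : Submodule ℝ (V → ℝ))
    (hW : ∀ v ∈ W, Λ * ipV μ v v ≤ -ipV μ (lapLin G w μ v) v) :
    ∃ u ∈ W, IsMinOn (Jab G w μ h α β) W u := by
  obtain ⟨a, ha, hnorm⟩ := exists_mul_norm_sq_le_ipV hμ
  refine (continuous_Jab hμ hh α β).continuousOn.exists_isMinOn' (x₀ := 0)
    W.closed_of_finiteDimensional W.zero_mem ?_
  set C := |β| * |Real.log (intV μ h)| with hC
  set J₀ := Jab G w μ h α β 0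
  have hb : 0 < (1 / 2) * ((Λ - α) * a) := by
    have := sub_pos.2 hα
    positivity
  set b := (1 / 2) * ((Λ - α) * a) with hbdef
  have hlower : ∀ v ∈ W, b * ‖v‖ ^ 2 - |β| * ‖v‖ - C ≤ Jab G w μ h α β v := by
    intro v hv
    rw [Jab_eq hws hμ]
    have h₁ := hW v hv
    have h₂ := mul_le_mul_of_nonneg_left (hnorm v) (sub_pos.2 hα).le
    have h₃ := mul_le_mul_of_nonneg_left (abs_log_intV_mul_exp_le hμ hh v) (abs_nonneg β)
    rw [← abs_mul] at h₃
    have h₄ := le_abs_self (β * Real.log (intV μ fun x => h x * Real.exp (v x)))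
    rw [hbdef, hC]
    linarith
  rw [Filter.eventually_inf_principal]
  filter_upwards [(tendsto_norm_cocompact_atTop (E := V → ℝ)).eventually_ge_atTop
    (max 1 ((|β| + C + |J₀|) / b))] with v hv hvW
  refine le_trans ?_ (hlower v hvW)
  have h₁ : 1 ≤ ‖v‖ := (le_max_left _ _).trans hv
  have h₂ : |β| + C + |J₀| ≤ ‖v‖ * b := (div_le_iff₀ hb).1 ((le_max_right _ _).trans hv)
  have h₃ : 0 ≤ C := by positivity
  have h₄ := le_abs_self J₀
  nlinarith [mul_le_mul_of_nonneg_left h₂ (norm_nonneg v), abs_nonneg J₀]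

theorem ipV_gradient_eq_zero_of_isMinOn [Nonempty V] (hws : ∀ x y, w x y = w y x)
    (hμ : ∀ x, 0 < μ x) (hh : ∀ x, 0 < h x) {α β : ℝ} {W : Submodule ℝ (V → ℝ)} {u : V → ℝ}
    (hu : u ∈ W) (hmin : IsMinOn (Jab G w μ h α β) W u) {v : V → ℝ} (hv : v ∈ W) :
    ipV μ (lapLin G w μ u + α • u
      + (β / intV μ fun x => h x * Real.exp (u x)) • fun x => h x * Real.exp (u x)) v = 0 := by
  set Z := intV μ fun x => h x * Real.exp (u x) with hZ
  have hexp : HasDerivAt (fun t : ℝ => intV μ fun x => h x * Real.exp ((u + t • v) x))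
      (ipV μ (fun x => h x * Real.exp (u x)) v) 0 := by
    simp only [intV, ipV_apply, Pi.add_apply, Pi.smul_apply, smul_eq_mul]
    refine HasDerivAt.fun_sum fun x _ => ?_
    have h₁ : HasDerivAt (fun t : ℝ => u x + t * v x) (1 * v x) 0 :=
      ((hasDerivAt_id (0 : ℝ)).mul_const (v x)).const_add (u x)
    refine ((h₁.exp.const_mul (h x)).const_mul (μ x)).congr_deriv ?_
    simp only [zero_mul, add_zero]
    ring
  have hlog := hexp.log (by simpa using (intV_mul_exp_pos hμ hh u).ne')
  simp only [zero_smul, add_zero, ← hZ] at hlog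
  have hquad : HasDerivAt (fun t : ℝ => (1 / 2) *
      (-ipV μ (lapLin G w μ (u + t • v)) (u + t • v) - α * ipV μ (u + t • v) (u + t • v)))
      (-ipV μ (lapLin G w μ u) v - α * ipV μ u v) 0 := by
    have h₃ : ipV μ (lapLin G w μ v) u = ipV μ (lapLin G w μ u) v := by
      rw [ipV_lapLin_comm hws hμ, ipV_comm]
    set A := -ipV μ (lapLin G w μ u) u - α * ipV μ u u with hA
    set B := -ipV μ (lapLin G w μ u) v - α * ipV μ u v with hB
    set D := -ipV μ (lapLin G w μ v) v - α * ipV μ v v with hD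
    have h₄ : (fun t : ℝ => (1 / 2) *
        (-ipV μ (lapLin G w μ (u + t • v)) (u + t • v) - α * ipV μ (u + t • v) (u + t • v)))
        = fun t => (1 / 2) * A + (t * B + t ^ 2 * ((1 / 2) * D)) := by
      funext t
      simp only [map_add, map_smul, LinearMap.add_apply, LinearMap.smul_apply, smul_eq_mul,
        h₃, ipV_comm μ v u, hA, hB, hD]
      ring
    rw [h₄]
    refine ((((hasDerivAt_id (0 : ℝ)).mul_const B).add
      (((hasDerivAt_id (0 : ℝ)).pow 2).mul_const ((1 / 2) * D))).const_add
        ((1 / 2) * A)).congr_deriv ?_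
    simp
  have hderiv := hquad.sub (hlog.const_mul β)
  have hloc : IsLocalMin (fun t : ℝ => Jab G w μ h α β (u + t • v)) 0 :=
    Filter.Eventually.of_forall fun t => by
      simpa using hmin (W.add_mem hu (W.smul_mem t hv))
  simp only [Jab_eq hws hμ] at hloc
  have h₀ := hloc.hasDerivAt_eq_zero hderiv
  simp only [map_add, map_smul, LinearMap.add_apply, LinearMap.smul_apply, smul_eq_mul]
  rw [div_mul_eq_mul_div, ← mul_div_assoc] at *
  linarith

end Functional

theorem stmt5 [Fintype V] (G : SimpleGraph V) [DecidableRel G.Adj]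
    (hG : G.Connected) (w : V → V → ℝ) (hws : ∀ x y, w x y = w y x)
    (hwp : ∀ x y, G.Adj x y → 0 < w x y)
    (μ : V → ℝ) (hμ : ∀ x, 0 < μ x) (h : V → ℝ) (hh : ∀ x, 0 < h x)
    (m : ℕ) (lam : Fin m → ℝ) (hmono : StrictMono lam)
    (hrange : ∀ c : ℝ, c ∈ Set.range lam ↔
      (c ≠ 0 ∧ ∃ v : V → ℝ, v ≠ 0 ∧ ∀ x, -(lapV G w μ v x) = c * v x))
    (n : Fin m → ℕ) (U : (s : Fin m) → Fin (n s) → V → ℝ)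
    (hUeig : ∀ s i, U s i ∈ eigSp G w μ (lam s))
    (hUon : ∀ s i j, intV μ (fun x => U s i x * U s j x) = if i = j then 1 else 0)
    (hUspan : ∀ s, ∀ v ∈ eigSp G w μ (lam s), v ∈ Submodule.span ℝ (Set.range (U s)))
    (k : ℕ) (hk : k < m) (α β : ℝ) (hα : α < lam ⟨k, hk⟩) :
    ∃ u ∈ EkPerp G w μ lam k,
      (∀ v ∈ EkPerp G w μ lam k, Jab G w μ h α β u ≤ Jab G w μ h α β v) ∧
      ∀ x, lapV G w μ u x + α * u x =
        -(β * h x * Real.exp (u x)) / intV μ (fun y => h y * Real.exp (u y))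
          + β / volV μ
          + ∑ s : Fin m, ∑ i : Fin (n s),
              if (s : ℕ) < k then
                (β * intV μ (fun y => h y * U s i y * Real.exp (u y))
                  / intV μ (fun y => h y * Real.exp (u y))) * U s i x
              else 0 := by
  have := hG.nonempty
  set W := perpSubmodule G w μ lam k
  obtain ⟨u, hu, hmin⟩ := exists_isMinOn_Jab (h := h) (G := G) hws hμ hh β hα W fun v hv =>
    lam_mul_ipV_le hG hws hwp hμ hmono (fun c hc hv => (hrange c).2 ⟨hc, hv⟩) hk hv
  refine ⟨u, hu, fun v hv => hmin hv, ?_⟩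
  set Z := intV μ (fun y => h y * Real.exp (u y)) with hZ
  have hZ0 : Z ≠ 0 := (intV_mul_exp_pos hμ hh u).ne'
  set f : V → ℝ := fun x => h x * Real.exp (u x) with hf
  have hvol : volV μ ≠ 0 := (sum_pos (fun x _ => hμ x) univ_nonempty).ne'
  have hu' := mem_perpSubmodule.1 hu
  have hL := mem_perpSubmodule.1 (lapLin_mem_perpSubmodule hws hμ hu)
  set g : V → ℝ := lapLin G w μ u + α • u + (β / Z) • f with hg
  set p : V → ℝ := (β / volV μ) • (1 : V → ℝ) + ∑ s : Fin m, ∑ i : Fin (n s),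
    (if (s : ℕ) < k then β / Z * ipV μ f (U s i) else 0) • U s i with hp
  have hU1 : ∀ s i, ipV μ (U s i) 1 = 0 := fun s i => (ipV_one μ _).trans (hUeig s i).1
  have hUU : ∀ s i j, ipV μ (U s i) (U s j) = if i = j then 1 else 0 := hUon
  have hUne : ∀ s t, s ≠ t → ∀ i j, ipV μ (U s i) (U t j) = 0 := fun s t hst i j =>
    ipV_eq_zero_of_eigenvalue_ne hws hμ (hmono.injective.ne hst) (hUeig s i) (hUeig t j)
  have hp_perp : ∀ v ∈ W, ipV μ p v = 0 := by
    intro v hv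
    have hv' := mem_perpSubmodule.1 hv
    simp only [hp, map_add, map_sum, map_smul, LinearMap.add_apply, LinearMap.smul_apply,
      LinearMap.sum_apply, smul_eq_mul]
    rw [ipV_comm, hv'.1, mul_zero, zero_add]
    refine sum_eq_zero fun s _ => sum_eq_zero fun i _ => ?_
    split_ifs with hs
    · rw [ipV_comm μ (U s i), hv'.2 s hs _ (hUeig s i), mul_zero]
    · exact zero_mul _
  have hmem : g - p ∈ W := by
    refine mem_perpSubmodule.2 ⟨?_, fun s hs v hv => ?_⟩
    · have h₁ : ipV μ f 1 = Z := ipV_one μ f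
      have h₂ : ipV μ 1 1 = volV μ := by simp [ipV_apply, volV]
      simp only [hg, hp, map_add, map_sub, map_sum, map_smul, LinearMap.add_apply,
        LinearMap.sub_apply, LinearMap.smul_apply, LinearMap.sum_apply, smul_eq_mul, hU1, hL.1,
        hu'.1, h₁, h₂, mul_zero, sum_const_zero, add_zero, zero_add]
      rw [div_mul_cancel₀ _ hZ0, div_mul_cancel₀ _ hvol, sub_self]
    · have hbasis : ∀ i, ipV μ (g - p) (U s i) = 0 := by
        intro i
        have h₁ : ∑ t : Fin m, ∑ j : Fin (n t), (if (t : ℕ) < k then β / Z * ipV μ f (U t j) else 0)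
            * ipV μ (U t j) (U s i) = β / Z * ipV μ f (U s i) := by
          rw [sum_eq_single s, sum_eq_single i]
          · rw [hUU, if_pos rfl, if_pos hs, mul_one]
          · intro j _ hj
            rw [hUU, if_neg hj, mul_zero]
          · simp
          · intro t _ ht
            exact sum_eq_zero fun j _ => by rw [hUne t s ht, mul_zero]
          · simp
        simp only [hg, hp, map_add, map_sub, map_sum, map_smul, LinearMap.add_apply,
          LinearMap.sub_apply, LinearMap.smul_apply, LinearMap.sum_apply, smul_eq_mul,
          hL.2 s hs _ (hUeig s i), hu'.2 s hs _ (hUeig s i), h₁, ipV_comm μ 1, hU1]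
        ring
      have hle : Submodule.span ℝ (Set.range (U s)) ≤ LinearMap.ker (ipV μ (g - p)) := by
        rw [Submodule.span_le]
        rintro _ ⟨i, rfl⟩
        exact hbasis i
      exact hle (hUspan s v hv)
  have hzero : g - p = 0 := by
    refine eq_zero_of_ipV_self hμ ?_
    have h₁ := ipV_gradient_eq_zero_of_isMinOn hws hμ hh hu hmin hmem
    have h₂ := hp_perp _ hmem
    rw [LinearMap.map_sub₂, h₂, sub_zero]
    exact h₁
  intro x
  have hx := congrFun (sub_eq_zero.1 hzero) x
  simp only [hg, hp, Pi.add_apply, Pi.smul_apply, Finset.sum_apply, smul_eq_mul, Pi.one_apply,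
    lapLin_apply, mul_one] at hx
  have hsum : ∀ s : Fin m, ∀ i : Fin (n s),
      (if (s : ℕ) < k then β * intV μ (fun y => h y * U s i y * Real.exp (u y)) / Z * U s i x
        else 0) = (if (s : ℕ) < k then β / Z * ipV μ f (U s i) else 0) * U s i x := by
    intro s i
    have h₁ : intV μ (fun y => h y * U s i y * Real.exp (u y)) = ipV μ f (U s i) :=
      sum_congr rfl fun y _ => by simp only [hf]; ring
    rw [h₁]
    split_ifs <;> ring
  simp only [hsum]
  have h₂ : -(β * h x * Real.exp (u x)) / Z = -(β / Z * f x) := by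
    simp only [hf]
    ring
  rw [h₂]
  linarith
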